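/- Let c > 0 and δ > 0. There is no differentiable function y : (0, δ] → ℝ such that 0 < y(x) < 1 and y′(x) ≥ c (1 − y(x)²)/(x y(x)) for all x ∈ (0, δ]. -/

import Mathlib

/-- Second integral estimate in the proof of Lemma 3.1: no differentiable
function `y : (0, δ] → ℝ` can satisfy `0 < y < 1` and
`y' ≥ c (1 - y²)/(x y)` on all of `(0, δ]`. -/
theorem stmt_13 (c δ : ℝ) (hc : 0 < c) (hδ : 0 < δ) :
    ¬ ∃ y y' : ℝ → ℝ, ∀ x : ℝ, 0 < x → x ≤ δ →
      HasDerivWithinAt y (y' x) (Set.Ioc 0 δ) x ∧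
      0 < y x ∧ y x < 1 ∧
      c * (1 - (y x) ^ 2) / (x * y x) ≤ y' x := by
  rintro ⟨y, y', h⟩
  have hder : ∀ x ∈ Set.Ioc 0 δ, HasDerivWithinAt
      (fun t => Real.log (1 - y t ^ 2) + 2 * c * Real.log t)
      (-(2 * y x * y' x) / (1 - y x ^ 2) + 2 * c * x⁻¹) (Set.Ioc 0 δ) x := by
    intro x hx
    obtain ⟨hd, h0, h1, -⟩ := h x hx.1 hx.2
    have hp : 1 - y x ^ 2 ≠ 0 := by nlinarith
    have hs : HasDerivWithinAt (fun t => 1 - y t ^ 2) (-(2 * y x * y' x)) (Set.Ioc 0 δ) x := by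
      simpa using (hd.fun_pow 2).const_sub 1
    exact (hs.log hp).add
      ((Real.hasDerivAt_log hx.1.ne').hasDerivWithinAt.const_mul (2 * c))
  have hanti : AntitoneOn (fun t => Real.log (1 - y t ^ 2) + 2 * c * Real.log t)
      (Set.Ioc 0 δ) := by
    refine antitoneOn_of_hasDerivWithinAt_nonpos (convex_Ioc 0 δ)
      (fun x hx => (hder x hx).continuousWithinAt)
      (fun x hx => (hder x (interior_subset hx)).mono interior_subset) ?_
    intro x hx
    obtain ⟨hx0, hxδ⟩ := interior_subset hx
    obtain ⟨-, h0, h1, hle⟩ := h x hx0 hxδ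
    have hp : 0 < 1 - y x ^ 2 := by nlinarith
    rw [div_le_iff₀ (mul_pos hx0 h0)] at hle
    have : 2 * c * x⁻¹ ≤ (2 * y x * y' x) / (1 - y x ^ 2) := by
      rw [← div_eq_mul_inv, div_le_div_iff₀ hx0 hp]
      linarith
    rw [neg_div]
    linarith
  set K := Real.log (1 - y δ ^ 2) + 2 * c * Real.log δ with hK
  set x := min δ (Real.exp ((K - 1) / (2 * c))) with hx
  have hx0 : 0 < x := lt_min hδ (Real.exp_pos _)
  have hxδ : x ≤ δ := min_le_left _ _
  have hKx : K ≤ Real.log (1 - y x ^ 2) + 2 * c * Real.log x :=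
    hanti ⟨hx0, hxδ⟩ ⟨hδ, le_rfl⟩ hxδ
  obtain ⟨-, h0, h1, -⟩ := h x hx0 hxδ
  have hlog : Real.log (1 - y x ^ 2) ≤ 0 :=
    Real.log_nonpos (by nlinarith) (by nlinarith)
  have hlogx : Real.log x ≤ (K - 1) / (2 * c) :=
    (Real.log_le_iff_le_exp hx0).2 (min_le_right _ _)
  rw [le_div_iff₀ (by positivity)] at hlogx
  linarith
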